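/- arXiv:1812.00792 — 8 statements merged into one kernel-verified Lean document; each statement's English description precedes it below -/
import Mathlib

section
/- Fix h > 0 and consider the DP problem with dynamics x(t+1) = x(t) + u(t) for t ∈ {0,1,2}, initial condition x(0) = 0, input set U = {−h, 0, h}, state constraint 0 ≤ x(t) ≤ h for all t ∈ {0,1,2,3}, and objective J_0(u, x) = −u(0) + u(1) − u(2)/2 + max_{0 ≤ k ≤ 3} x(k). Then: (i) the input sequence u* = (h, −h, h), with resulting trajectory x* = (0, h, 0, h), is feasible and satisfies J_0(u*, x*) = −3h/2 ≤ J_0(u, x) for every feasible (u, x); (ii) for the subproblem started at time 2 from state 0, with objective J_2(u, x) = −u(2)/2 + max_{2 ≤ k ≤ 3} x(k), the truncated input (h) with trajectory (0, h) yields objective value h/2, while the feasible input (0) with trajectory (0, 0) yields the strictly smaller value 0. Hence the truncation of the optimal input sequence is not optimal for the subproblem, so this problem does not satisfy the Principle of Optimality. -/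
/-- Feasibility for the counterexample problem started at time `t` from state `x0`:
dynamics `x(s+1) = x(s) + u(s)`, inputs in `{-h, 0, h}`, and state constraint
`0 ≤ x(s) ≤ h` for all relevant times up to `T = 3`. -/
def Feas1 (h : ℝ) (t : ℕ) (x0 : ℝ) (u x : ℕ → ℝ) : Prop :=
  x t = x0 ∧
  (∀ s, t ≤ s → s < 3 → u s ∈ ({-h, 0, h} : Set ℝ) ∧ x (s + 1) = x s + u s) ∧
  (∀ s, t ≤ s → s ≤ 3 → 0 ≤ x s ∧ x s ≤ h)

/-- the DP problem with objective
`J_0(u,x) = -u(0) + u(1) - u(2)/2 + max_{0 ≤ k ≤ 3} x(k)` does not satisfy the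
Principle of Optimality: the input `u* = (h, -h, h)` with trajectory `x* = (0, h, 0, h)`
is optimal for the problem started at `(0, 0)` with value `-3h/2`, yet for the
subproblem started at time `2` from state `0`, with objective
`J_2(u,x) = -u(2)/2 + max_{2 ≤ k ≤ 3} x(k)`, the truncated input `(h)` gives value `h/2`
while the feasible input `(0)` gives the strictly smaller value `0`. -/
theorem max_objective_violates_principle_of_optimality
    (h : ℝ) (hh : 0 < h)
    (ustar xstar : ℕ → ℝ)
    (hu0 : ustar 0 = h) (hu1 : ustar 1 = -h) (hu2 : ustar 2 = h)
    (hx0 : xstar 0 = 0) (hx1 : xstar 1 = h) (hx2 : xstar 2 = 0) (hx3 : xstar 3 = h) :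
    -- (i) (u*, x*) is feasible and optimal for the problem started at (0, 0)
    (Feas1 h 0 0 ustar xstar) ∧
    (-(ustar 0) + ustar 1 - ustar 2 / 2
        + max (max (xstar 0) (xstar 1)) (max (xstar 2) (xstar 3)) = -(3 * h) / 2) ∧
    (∀ u x, Feas1 h 0 0 u x →
      -(3 * h) / 2 ≤ -(u 0) + u 1 - u 2 / 2 + max (max (x 0) (x 1)) (max (x 2) (x 3))) ∧
    -- (ii) for the subproblem started at time 2 from state 0, the truncation of (u*, x*)
    -- is feasible with objective value h/2 ...
    (Feas1 h 2 0 ustar xstar) ∧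
    (-(ustar 2) / 2 + max (xstar 2) (xstar 3) = h / 2) ∧
    -- ... while the input u(2) = 0 (trajectory (0,0)) is feasible with the strictly
    -- smaller objective value 0; hence the truncation is not optimal for the subproblem.
    (∀ u x, u 2 = 0 → x 2 = 0 → x 3 = 0 →
      Feas1 h 2 0 u x ∧
      -(u 2) / 2 + max (x 2) (x 3) = 0 ∧
      -(u 2) / 2 + max (x 2) (x 3) < -(ustar 2) / 2 + max (xstar 2) (xstar 3)) := by
  refine ⟨⟨hx0, fun s _ hs3 => ?_, fun s _ hs3 => ?_⟩, ?_, fun u x ⟨hxi, hstep, hstate⟩ => ?_,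
    ⟨hx2, fun s hs hs3 => ?_, fun s hs hs3 => ?_⟩, ?_, fun u x hu hxa hxb => ?_⟩
  · interval_cases s <;> simp [hu0, hu1, hu2, hx0, hx1, hx2, hx3]
  · interval_cases s <;> simp [hx0, hx1, hx2, hx3, hh.le]
  · simp only [hu0, hu1, hu2, hx0, hx1, hx2, hx3, max_eq_right hh.le, max_self]
    ring
  · have e0 := (hstep 0 le_rfl (by norm_num)).2
    have e1 := (hstep 1 (by norm_num) (by norm_num)).2
    have e2 := (hstep 2 (by norm_num) (by norm_num)).2
    norm_num at e0 e1 e2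
    have hle1 : x 1 ≤ max (max (x 0) (x 1)) (max (x 2) (x 3)) := by simp
    have hle3 : x 3 ≤ max (max (x 0) (x 1)) (max (x 2) (x 3)) := by simp
    linarith [(hstate 1 (by norm_num) (by norm_num)).2, (hstate 2 (by norm_num) (by norm_num)).1]
  · interval_cases s
    simp [hu2, hx2, hx3]
  · interval_cases s <;> simp [hx2, hx3, hh.le]
  · rw [hu2, hx2, hx3, max_eq_right hh.le]
    ring
  · refine ⟨⟨hxa, fun s hs hs3 => ?_, fun s hs hs3 => ?_⟩, ?_, ?_⟩
    · interval_cases s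
      simp [hu, hxa, hxb]
    · interval_cases s <;> simp [hxa, hxb, hh.le]
    · simp [hu, hxa, hxb]
    · rw [hu, hxa, hxb, hu2, hx2, hx3, max_eq_right hh.le, max_self]
      linarith
end

section
/- Assume that for every t ∈ {t0, …, T−1} and every x ∈ X_t the set Γ_{t,x} = {u ∈ U : f(x, u, t) ∈ X_{t+1}} is nonempty, that for every t and x ∈ X_t there exists at least one feasible pair for P(t, x), and that for every t and x ∈ X_t the set of objective values {J_t(u, x̄) : (u, x̄) feasible for P(t, x)} is bounded below. Define F(x, t) = inf{J_t(u, x̄) : (u, x̄) feasible for P(t, x)} for x ∈ X_t and t0 ≤ t ≤ T−1, and F(x, T) = c_T(x) for x ∈ X_T. Then for all t ∈ {t0, …, T−1} and all x ∈ X_t, F(x, t) = inf_{u ∈ Γ_{t,x}} { c_t(x, u) + F(f(x, u, t), t+1) } (Bellman's equation). -/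
/-- Feasibility of the pair `(u, x)` for the deterministic problem `P(t, x0)`. -/
def Feasible {n m : ℕ} (T : ℕ)
    (f : (Fin n → ℝ) → (Fin m → ℝ) → ℕ → (Fin n → ℝ))
    (X : ℕ → Set (Fin n → ℝ)) (U : Set (Fin m → ℝ))
    (t : ℕ) (x0 : Fin n → ℝ)
    (u : ℕ → (Fin m → ℝ)) (x : ℕ → (Fin n → ℝ)) : Prop :=
  x t = x0 ∧
  (∀ s, t ≤ s → s < T → x (s + 1) = f (x s) (u s) s) ∧
  (∀ s, t ≤ s → s < T → u s ∈ U) ∧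
  (∀ s, t ≤ s → s ≤ T → x s ∈ X s)

/-- The additively separable objective
`J_t(u, x) = Σ_{s=t}^{T-1} c_s(x(s), u(s)) + c_T(x(T))`. -/
def Obj {n m : ℕ} (T : ℕ)
    (c : ℕ → (Fin n → ℝ) → (Fin m → ℝ) → ℝ) (cT : (Fin n → ℝ) → ℝ)
    (t : ℕ) (u : ℕ → (Fin m → ℝ)) (x : ℕ → (Fin n → ℝ)) : ℝ :=
  (∑ s ∈ Finset.Ico t T, c s (x s) (u s)) + cT (x T)

theorem Feasible.tail {n m T t : ℕ}
    {f : (Fin n → ℝ) → (Fin m → ℝ) → ℕ → (Fin n → ℝ)}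
    {X : ℕ → Set (Fin n → ℝ)} {U : Set (Fin m → ℝ)} {x0 : Fin n → ℝ}
    {u : ℕ → (Fin m → ℝ)} {x : ℕ → (Fin n → ℝ)}
    (h : Feasible T f X U t x0 u x) (ht : t < T) :
    Feasible T f X U (t + 1) (f x0 (u t) t) u x := by
  obtain ⟨rfl, hdyn, hU, hX⟩ := h
  exact ⟨hdyn t le_rfl ht, fun s hs => hdyn s (by lia), fun s hs => hU s (by lia),
    fun s hs => hX s (by lia)⟩

theorem Feasible.cons {n m T t : ℕ}
    {f : (Fin n → ℝ) → (Fin m → ℝ) → ℕ → (Fin n → ℝ)}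
    {X : ℕ → Set (Fin n → ℝ)} {U : Set (Fin m → ℝ)} {x0 : Fin n → ℝ} {v : Fin m → ℝ}
    {u : ℕ → (Fin m → ℝ)} {x : ℕ → (Fin n → ℝ)}
    (h : Feasible T f X U (t + 1) (f x0 v t) u x) (hx0 : x0 ∈ X t) (hv : v ∈ U) :
    Feasible T f X U t x0 (Function.update u t v) (Function.update x t x0) := by
  obtain ⟨h0, hdyn, hU, hX⟩ := h
  refine ⟨by simp, fun s hs hsT => ?_, fun s hs hsT => ?_, fun s hs hsT => ?_⟩ <;>
    rcases hs.eq_or_lt with rfl | hlt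
  · simp [h0]
  · rw [Function.update_of_ne (by lia), Function.update_of_ne (by lia),
      Function.update_of_ne (by lia)]
    exact hdyn s hlt hsT
  · simpa using hv
  · rw [Function.update_of_ne (by lia)]
    exact hU s hlt hsT
  · simpa using hx0
  · rw [Function.update_of_ne (by lia)]
    exact hX s hlt hsT

theorem Obj_eq_add_Obj_succ {n m T t : ℕ}
    (c : ℕ → (Fin n → ℝ) → (Fin m → ℝ) → ℝ) (cT : (Fin n → ℝ) → ℝ)
    (u : ℕ → (Fin m → ℝ)) (x : ℕ → (Fin n → ℝ)) (ht : t < T) :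
    Obj T c cT t u x = c t (x t) (u t) + Obj T c cT (t + 1) u x := by
  simp only [Obj]
  rw [Finset.sum_eq_sum_Ico_succ_bot ht, add_assoc]

theorem Obj_update {n m T t : ℕ}
    (c : ℕ → (Fin n → ℝ) → (Fin m → ℝ) → ℝ) (cT : (Fin n → ℝ) → ℝ)
    (u : ℕ → (Fin m → ℝ)) (x : ℕ → (Fin n → ℝ)) (v : Fin m → ℝ) (x0 : Fin n → ℝ)
    (ht : t < T) :
    Obj T c cT t (Function.update u t v) (Function.update x t x0) =
      c t x0 v + Obj T c cT (t + 1) u x := by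
  rw [Obj_eq_add_Obj_succ c cT _ _ ht, Function.update_self, Function.update_self]
  congr 1
  simp only [Obj]
  rw [Function.update_of_ne ht.ne']
  congr 1
  refine Finset.sum_congr rfl fun s hs => ?_
  have hst : s ≠ t := by
    rw [Finset.mem_Ico] at hs
    lia
  rw [Function.update_of_ne hst, Function.update_of_ne hst]

/-- At the terminal time the only attainable objective value is the terminal cost. -/
theorem setOf_Obj_terminal {n m T : ℕ}
    (f : (Fin n → ℝ) → (Fin m → ℝ) → ℕ → (Fin n → ℝ))
    (c : ℕ → (Fin n → ℝ) → (Fin m → ℝ) → ℝ) (cT : (Fin n → ℝ) → ℝ)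
    (X : ℕ → Set (Fin n → ℝ)) (U : Set (Fin m → ℝ)) {x : Fin n → ℝ} (hx : x ∈ X T) :
    {r : ℝ | ∃ u xx, Feasible T f X U T x u xx ∧ Obj T c cT T u xx = r} = {cT x} := by
  ext r
  constructor
  · rintro ⟨u, xx, ⟨rfl, -⟩, rfl⟩
    simp [Obj]
  · rintro rfl
    refine ⟨0, fun _ => x, ⟨rfl, fun s h h' => by lia, fun s h h' => by lia,
      fun s h h' => ?_⟩, by simp [Obj]⟩
    rwa [le_antisymm h' h]

/-- Bellman's equation.  If every `Γ_{t,x}` is nonempty, feasible pairs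
exist from every `(t, x)` with `x ∈ X t`, and the sets of attainable objective values
are bounded below, then the value function `F(x,t) = inf { J_t(u, x̄) : (u, x̄) feasible
for P(t, x) }` (with `F(x, T) = c_T(x)`) satisfies
`F(x,t) = inf_{u ∈ Γ_{t,x}} { c_t(x,u) + F(f(x,u,t), t+1) }`. -/
theorem bellman_equation {n m : ℕ} (t0 T : ℕ) (ht0T : t0 < T)
    (f : (Fin n → ℝ) → (Fin m → ℝ) → ℕ → (Fin n → ℝ))
    (c : ℕ → (Fin n → ℝ) → (Fin m → ℝ) → ℝ) (cT : (Fin n → ℝ) → ℝ)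
    (X : ℕ → Set (Fin n → ℝ)) (U : Set (Fin m → ℝ))
    (hΓ : ∀ t x, t0 ≤ t → t < T → x ∈ X t → ∃ u ∈ U, f x u t ∈ X (t + 1))
    (hfeas : ∀ t x, t0 ≤ t → t < T → x ∈ X t → ∃ u xx, Feasible T f X U t x u xx)
    (hbdd : ∀ t x, t0 ≤ t → t < T → x ∈ X t →
      BddBelow {r : ℝ | ∃ u xx, Feasible T f X U t x u xx ∧ Obj T c cT t u xx = r})
    (F : (Fin n → ℝ) → ℕ → ℝ)
    (hFdef : ∀ t x, t0 ≤ t → t < T → x ∈ X t →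
      F x t = sInf {r : ℝ | ∃ u xx, Feasible T f X U t x u xx ∧ Obj T c cT t u xx = r})
    (hFT : ∀ x, x ∈ X T → F x T = cT x) :
    ∀ t x, t0 ≤ t → t < T → x ∈ X t →
      F x t = sInf {r : ℝ |
        ∃ u ∈ U, f x u t ∈ X (t + 1) ∧ c t x u + F (f x u t) (t + 1) = r} := by
  have hglb : ∀ t x, t0 ≤ t → t ≤ T → x ∈ X t →
      IsGLB {r : ℝ | ∃ u xx, Feasible T f X U t x u xx ∧ Obj T c cT t u xx = r} (F x t) := by
    intro t x ht htT hx
    rcases htT.eq_or_lt with rfl | hlt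
    · rw [setOf_Obj_terminal f c cT X U hx, hFT x hx]
      exact isGLB_singleton
    · rw [hFdef t x ht hlt hx]
      obtain ⟨u, xx, h⟩ := hfeas t x ht hlt hx
      exact isGLB_csInf ⟨_, u, xx, h, rfl⟩ (hbdd t x ht hlt hx)
  intro t x ht htT hx
  obtain ⟨v, hv, hvX⟩ := hΓ t x ht htT hx
  symm
  refine IsGLB.csInf_eq ⟨?_, fun b hb => ?_⟩ ⟨_, v, hv, hvX, rfl⟩
  · rintro _ ⟨w, hw, hwX, rfl⟩
    rw [← sub_le_iff_le_add']
    refine (hglb (t + 1) _ (by lia) htT hwX).2 ?_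
    rintro _ ⟨u, xx, h, rfl⟩
    rw [sub_le_iff_le_add', ← Obj_update c cT u xx w x htT]
    exact (hglb t x ht htT.le hx).1 ⟨_, _, h.cons hx hw, rfl⟩
  · refine (hglb t x ht htT.le hx).2 ?_
    rintro _ ⟨u, xx, h, rfl⟩
    have htail := h.tail htT
    have hX : f x (u t) t ∈ X (t + 1) := by
      rw [← htail.1]
      exact htail.2.2.2 (t + 1) le_rfl htT
    rw [Obj_eq_add_Obj_succ c cT u xx htT, h.1]
    exact (hb ⟨u t, h.2.2.1 t le_rfl htT, hX, rfl⟩).trans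
      (add_le_add_right ((hglb (t + 1) _ (by lia) htT hX).1 ⟨u, xx, htail, rfl⟩) _)
end

section
/- Let J_{t0} be the forward separable objective of the problem H(t0, x0), with representation maps φ_i, and let A(t0, x0) be the associated augmented-state problem. Then: (i) the optimal values coincide, i.e. inf over feasible pairs of J_{t0} for H(t0, x0) equals inf over feasible pairs of L_{t0} for A(t0, x0); (ii) if (w, z) with z = ((z1(t0), z2(t0)), …, (z1(T), z2(T))) solves A(t0, x0), then (w, z1) solves H(t0, x0); and (iii) if (u, x) solves H(t0, x0), then (u, z) solves A(t0, x0), where z1 = x and z2 is defined by the augmented recursion z2(t0) = 0, z2(t0+1) = φ_{t0}(x(t0), u(t0)), z2(t+1) = φ_t(x(t), u(t), z2(t)). -/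
/-- `IsFSRep n m t0 T J d φ0 φ φT` says that the maps `(φ_i)` form a forward separable
representation of `J` with dimensions `d`: for all `u, x`, if `w` satisfies the forward
recursion `w(t0) = φ_{t0}(x(t0), u(t0))`, `w(i) = φ_i(x(i), u(i), w(i-1))` for
`t0 < i ≤ T-1`, then `J(u, x) = φ_T(x(T), w(T-1))`. -/
def IsFSRep (n m t0 T : ℕ)
    (J : (ℕ → (Fin m → ℝ)) → (ℕ → (Fin n → ℝ)) → ℝ)
    (d : ℕ → ℕ)
    (φ0 : (Fin n → ℝ) → (Fin m → ℝ) → (Fin (d t0) → ℝ))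
    (φ : (i : ℕ) → (Fin n → ℝ) → (Fin m → ℝ) → (Fin (d (i - 1)) → ℝ) → (Fin (d i) → ℝ))
    (φT : (Fin n → ℝ) → (Fin (d (T - 1)) → ℝ) → ℝ) : Prop :=
  ∀ (u : ℕ → (Fin m → ℝ)) (x : ℕ → (Fin n → ℝ)) (w : (i : ℕ) → (Fin (d i) → ℝ)),
    w t0 = φ0 (x t0) (u t0) →
    (∀ i, t0 < i → i ≤ T - 1 → w i = φ i (x i) (u i) (w (i - 1))) →
    J u x = φT (x T) (w (T - 1))

/-- `J` admits a forward separable representation of dimension (exactly) `l`,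
i.e. with `max_{t0 ≤ i ≤ T-1} d_i = l`. -/
def HasFSRepDim (n m t0 T l : ℕ)
    (J : (ℕ → (Fin m → ℝ)) → (ℕ → (Fin n → ℝ)) → ℝ) : Prop :=
  ∃ (d : ℕ → ℕ)
    (φ0 : (Fin n → ℝ) → (Fin m → ℝ) → (Fin (d t0) → ℝ))
    (φ : (i : ℕ) → (Fin n → ℝ) → (Fin m → ℝ) → (Fin (d (i - 1)) → ℝ) → (Fin (d i) → ℝ))
    (φT : (Fin n → ℝ) → (Fin (d (T - 1)) → ℝ) → ℝ),
    (∀ i, t0 ≤ i → i ≤ T - 1 → d i ≤ l) ∧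
    (∃ i, t0 ≤ i ∧ i ≤ T - 1 ∧ d i = l) ∧
    IsFSRep n m t0 T J d φ0 φ φT

/-- `J` admits a forward separable representation of dimension at most `l`,
i.e. with `max_{t0 ≤ i ≤ T-1} d_i ≤ l`. -/
def HasFSRepDimLe (n m t0 T l : ℕ)
    (J : (ℕ → (Fin m → ℝ)) → (ℕ → (Fin n → ℝ)) → ℝ) : Prop :=
  ∃ (d : ℕ → ℕ)
    (φ0 : (Fin n → ℝ) → (Fin m → ℝ) → (Fin (d t0) → ℝ))
    (φ : (i : ℕ) → (Fin n → ℝ) → (Fin m → ℝ) → (Fin (d (i - 1)) → ℝ) → (Fin (d i) → ℝ))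
    (φT : (Fin n → ℝ) → (Fin (d (T - 1)) → ℝ) → ℝ),
    (∀ i, t0 ≤ i → i ≤ T - 1 → d i ≤ l) ∧
    IsFSRep n m t0 T J d φ0 φ φT

/-- Feasibility of `(u, x)` for the forward separable problem `H(t0, x0)`. -/
def FeasH {n m : ℕ} (T : ℕ)
    (f : (Fin n → ℝ) → (Fin m → ℝ) → ℕ → (Fin n → ℝ))
    (X : ℕ → Set (Fin n → ℝ)) (U : Set (Fin m → ℝ))
    (t0 : ℕ) (x0 : Fin n → ℝ)
    (u : ℕ → (Fin m → ℝ)) (x : ℕ → (Fin n → ℝ)) : Prop :=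
  x t0 = x0 ∧
  (∀ t, t0 ≤ t → t < T → x (t + 1) = f (x t) (u t) t) ∧
  (∀ t, t0 ≤ t → t < T → u t ∈ U) ∧
  (∀ t, t0 ≤ t → t ≤ T → x t ∈ X t)

/-- Feasibility of `(u, (z1, z2))` for the augmented problem `A(t0, x0)`:
`z1(t0) = x0`, `z2(t0) = 0`, `z1(t+1) = f(z1(t), u(t), t)`,
`z2(t0+1) = φ_{t0}(z1(t0), u(t0))`, `z2(t+1) = φ_t(z1(t), u(t), z2(t))` for
`t0+1 ≤ t ≤ T-1`, with `z1(t) ∈ X t` and `u(t) ∈ U`. -/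
def FeasA {n m : ℕ} (T : ℕ)
    (f : (Fin n → ℝ) → (Fin m → ℝ) → ℕ → (Fin n → ℝ))
    (X : ℕ → Set (Fin n → ℝ)) (U : Set (Fin m → ℝ))
    (t0 : ℕ) (d : ℕ → ℕ)
    (φ0 : (Fin n → ℝ) → (Fin m → ℝ) → (Fin (d t0) → ℝ))
    (φ : (i : ℕ) → (Fin n → ℝ) → (Fin m → ℝ) → (Fin (d (i - 1)) → ℝ) → (Fin (d i) → ℝ))
    (x0 : Fin n → ℝ)
    (u : ℕ → (Fin m → ℝ)) (z1 : ℕ → (Fin n → ℝ))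
    (z2 : (i : ℕ) → (Fin (d (i - 1)) → ℝ)) : Prop :=
  z1 t0 = x0 ∧
  (∀ i, z2 t0 i = 0) ∧
  (∀ t, t0 ≤ t → t < T → z1 (t + 1) = f (z1 t) (u t) t) ∧
  z2 (t0 + 1) = φ0 (z1 t0) (u t0) ∧
  (∀ t, t0 + 1 ≤ t → t < T → z2 (t + 1) = φ t (z1 t) (u t) (z2 t)) ∧
  (∀ t, t0 ≤ t → t < T → u t ∈ U) ∧
  (∀ t, t0 ≤ t → t ≤ T → z1 t ∈ X t)

/-- The augmented state trajectory generated by the forward recursion along `(u, x)`. -/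
noncomputable def augmentedState {n m : ℕ} (t0 : ℕ) (d : ℕ → ℕ)
    (φ0 : (Fin n → ℝ) → (Fin m → ℝ) → (Fin (d t0) → ℝ))
    (φ : (i : ℕ) → (Fin n → ℝ) → (Fin m → ℝ) → (Fin (d (i - 1)) → ℝ) → (Fin (d i) → ℝ))
    (u : ℕ → (Fin m → ℝ)) (x : ℕ → (Fin n → ℝ)) : (i : ℕ) → (Fin (d (i - 1)) → ℝ)
  | 0 => fun _ => 0
  | t + 1 =>
    if h : t0 = t then h ▸ φ0 (x t0) (u t0)
    else if t < t0 then fun _ => 0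
    else φ t (x t) (u t) (augmentedState t0 d φ0 φ u x t)

section

variable {n m t0 T : ℕ}
  {f : (Fin n → ℝ) → (Fin m → ℝ) → ℕ → (Fin n → ℝ)}
  {X : ℕ → Set (Fin n → ℝ)} {U : Set (Fin m → ℝ)}
  {J : (ℕ → (Fin m → ℝ)) → (ℕ → (Fin n → ℝ)) → ℝ} {d : ℕ → ℕ}
  {φ0 : (Fin n → ℝ) → (Fin m → ℝ) → (Fin (d t0) → ℝ)}
  {φ : (i : ℕ) → (Fin n → ℝ) → (Fin m → ℝ) → (Fin (d (i - 1)) → ℝ) → (Fin (d i) → ℝ)}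
  {φT : (Fin n → ℝ) → (Fin (d (T - 1)) → ℝ) → ℝ}
  {x0 : Fin n → ℝ} {u : ℕ → (Fin m → ℝ)} {x : ℕ → (Fin n → ℝ)}
  {z2 : (i : ℕ) → (Fin (d (i - 1)) → ℝ)}

theorem FeasA.feasH (h : FeasA T f X U t0 d φ0 φ x0 u x z2) : FeasH T f X U t0 x0 u x :=
  ⟨h.1, h.2.2.1, h.2.2.2.2.2.1, h.2.2.2.2.2.2⟩

theorem FeasA.objective_eq (ht0T : t0 < T) (hJ : IsFSRep n m t0 T J d φ0 φ φT)
    (h : FeasA T f X U t0 d φ0 φ x0 u x z2) : J u x = φT (x T) (z2 T) := by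
  obtain ⟨-, -, -, h0, hs, -, -⟩ := h
  obtain ⟨k, rfl⟩ : ∃ k, T = k + 1 := ⟨T - 1, by omega⟩
  refine hJ u x (fun i => z2 (i + 1)) h0 fun i hi hiT => ?_
  obtain ⟨j, rfl⟩ : ∃ j, i = j + 1 := ⟨i - 1, by omega⟩
  exact hs (j + 1) hi (Nat.lt_succ_of_le hiT)

theorem FeasH.feasA_augmentedState (h : FeasH T f X U t0 x0 u x) :
    FeasA T f X U t0 d φ0 φ x0 u x (augmentedState t0 d φ0 φ u x) := by
  refine ⟨h.1, ?_, h.2.1, ?_, fun t ht _ => ?_, h.2.2.1, h.2.2.2⟩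
  · cases t0 with
    | zero => exact fun _ => rfl
    | succ k => intro i; simp [augmentedState]
  · simp [augmentedState]
  · rw [augmentedState, dif_neg (by omega), if_neg (by omega)]

end

/-- equivalence of the forward separable problem `H(t0, x0)` and its
augmented problem `A(t0, x0)`: (i) the optimal values coincide; (ii) any solution
`(w, z)` of `A(t0, x0)` yields the solution `(w, z1)` of `H(t0, x0)`; and (iii) any
solution `(u, x)` of `H(t0, x0)`, together with the `z2` generated by the augmented
recursion, solves `A(t0, x0)`. -/
theorem augmented_problem_equivalent
    {n m : ℕ} (t0 T : ℕ) (ht0T : t0 < T)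
    (f : (Fin n → ℝ) → (Fin m → ℝ) → ℕ → (Fin n → ℝ))
    (X : ℕ → Set (Fin n → ℝ)) (U : Set (Fin m → ℝ))
    (J : (ℕ → (Fin m → ℝ)) → (ℕ → (Fin n → ℝ)) → ℝ)
    (d : ℕ → ℕ)
    (φ0 : (Fin n → ℝ) → (Fin m → ℝ) → (Fin (d t0) → ℝ))
    (φ : (i : ℕ) → (Fin n → ℝ) → (Fin m → ℝ) → (Fin (d (i - 1)) → ℝ) → (Fin (d i) → ℝ))
    (φT : (Fin n → ℝ) → (Fin (d (T - 1)) → ℝ) → ℝ)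
    (hJ : IsFSRep n m t0 T J d φ0 φ φT) :
    -- (i) the optimal values of H(t0, x0) and A(t0, x0) coincide
    (∀ x0 : Fin n → ℝ,
      sInf {r : ℝ | ∃ u x, FeasH T f X U t0 x0 u x ∧ J u x = r} =
      sInf {r : ℝ | ∃ u z1 z2, FeasA T f X U t0 d φ0 φ x0 u z1 z2 ∧
        φT (z1 T) (z2 T) = r}) ∧
    -- (ii) a solution of A(t0, x0) yields a solution of H(t0, x0)
    (∀ (x0 : Fin n → ℝ) (w : ℕ → (Fin m → ℝ)) (z1 : ℕ → (Fin n → ℝ))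
        (z2 : (i : ℕ) → (Fin (d (i - 1)) → ℝ)),
      FeasA T f X U t0 d φ0 φ x0 w z1 z2 →
      (∀ w' z1' z2', FeasA T f X U t0 d φ0 φ x0 w' z1' z2' →
        φT (z1 T) (z2 T) ≤ φT (z1' T) (z2' T)) →
      (FeasH T f X U t0 x0 w z1 ∧
        ∀ u' x', FeasH T f X U t0 x0 u' x' → J w z1 ≤ J u' x')) ∧
    -- (iii) a solution of H(t0, x0), with z2 generated by the augmented recursion,
    -- yields a solution of A(t0, x0)
    (∀ (x0 : Fin n → ℝ) (u : ℕ → (Fin m → ℝ)) (x : ℕ → (Fin n → ℝ)),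
      FeasH T f X U t0 x0 u x →
      (∀ u' x', FeasH T f X U t0 x0 u' x' → J u x ≤ J u' x') →
      ∀ z2 : (i : ℕ) → (Fin (d (i - 1)) → ℝ),
        (∀ i, z2 t0 i = 0) →
        z2 (t0 + 1) = φ0 (x t0) (u t0) →
        (∀ t, t0 + 1 ≤ t → t < T → z2 (t + 1) = φ t (x t) (u t) (z2 t)) →
        (FeasA T f X U t0 d φ0 φ x0 u x z2 ∧
          ∀ u' z1' z2', FeasA T f X U t0 d φ0 φ x0 u' z1' z2' →
            φT (x T) (z2 T) ≤ φT (z1' T) (z2' T))) := by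
  refine ⟨fun x0 => ?_, fun x0 w z1 z2 hA hmin => ⟨hA.feasH, fun u' x' hH => ?_⟩,
    fun x0 u x hH hmin z2 hz hz0 hzs => ?_⟩
  · congr 1
    ext r
    constructor
    · rintro ⟨u, x, hH, rfl⟩
      exact ⟨u, x, _, hH.feasA_augmentedState,
        (hH.feasA_augmentedState.objective_eq ht0T hJ).symm⟩
    · rintro ⟨u, z1, z2, hA, rfl⟩
      exact ⟨u, z1, hA.feasH, hA.objective_eq ht0T hJ⟩
  · have hA' : FeasA T f X U t0 d φ0 φ x0 u' x' _ := hH.feasA_augmentedState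
    rw [hA.objective_eq ht0T hJ, hA'.objective_eq ht0T hJ]
    exact hmin _ _ _ hA'
  · have hA : FeasA T f X U t0 d φ0 φ x0 u x z2 :=
      ⟨hH.1, hz, hH.2.1, hz0, hzs, hH.2.2.1, hH.2.2.2⟩
    refine ⟨hA, fun u' z1' z2' hA' => ?_⟩
    rw [← hA.objective_eq ht0T hJ, ← hA'.objective_eq ht0T hJ]
    exact hmin _ _ hA'.feasH
end

section
/- The augmented-state problem satisfies the Principle of Optimality: for t0 ≤ t < s < T, if (u*, z*) is feasible for A(t, (x, w)) and L_t(u*, z*) ≤ L_t(u, z) for every feasible pair, then the truncation ((u*(s), …, u*(T−1)), (z*(s), …, z*(T))) is feasible for the augmented problem started at time s from augmented state z*(s) = (z1*(s), z2*(s)) and minimizes the objective φ_T(z1(T), z2(T)) over all pairs feasible for that subproblem. -/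
/-- Feasibility of `(u, (z1, z2))` for the augmented problem started at time `t` from
augmented state `(xinit, winit)`: `z1(t) = xinit`, `z2(t) = winit`,
`z1(s+1) = f(z1(s), u(s), s)` and `z2(s+1) = φ_s(z1(s), u(s), z2(s))` for
`t ≤ s ≤ T-1`, with `u(s) ∈ U` and `z1(s) ∈ X s`. -/
def FeasAug {n m : ℕ} (T : ℕ)
    (f : (Fin n → ℝ) → (Fin m → ℝ) → ℕ → (Fin n → ℝ))
    (X : ℕ → Set (Fin n → ℝ)) (U : Set (Fin m → ℝ))
    (d : ℕ → ℕ)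
    (φ : (i : ℕ) → (Fin n → ℝ) → (Fin m → ℝ) → (Fin (d (i - 1)) → ℝ) → (Fin (d i) → ℝ))
    (t : ℕ) (xinit : Fin n → ℝ) (winit : Fin (d (t - 1)) → ℝ)
    (u : ℕ → (Fin m → ℝ)) (z1 : ℕ → (Fin n → ℝ))
    (z2 : (i : ℕ) → (Fin (d (i - 1)) → ℝ)) : Prop :=
  z1 t = xinit ∧
  z2 t = winit ∧
  (∀ s, t ≤ s → s < T → z1 (s + 1) = f (z1 s) (u s) s) ∧
  (∀ s, t ≤ s → s < T → z2 (s + 1) = φ s (z1 s) (u s) (z2 s)) ∧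
  (∀ s, t ≤ s → s < T → u s ∈ U) ∧
  (∀ s, t ≤ s → s ≤ T → z1 s ∈ X s)

section

variable {n m : ℕ} {T : ℕ}
  {f : (Fin n → ℝ) → (Fin m → ℝ) → ℕ → (Fin n → ℝ)}
  {X : ℕ → Set (Fin n → ℝ)} {U : Set (Fin m → ℝ)} {d : ℕ → ℕ}
  {φ : (i : ℕ) → (Fin n → ℝ) → (Fin m → ℝ) → (Fin (d (i - 1)) → ℝ) → (Fin (d i) → ℝ)}
  {t s : ℕ} {x : Fin n → ℝ} {w : Fin (d (t - 1)) → ℝ}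
  {u v : ℕ → (Fin m → ℝ)} {z1 y1 : ℕ → (Fin n → ℝ)}
  {z2 y2 : (i : ℕ) → (Fin (d (i - 1)) → ℝ)}

/-- The truncation of a feasible pair is feasible from the state it reaches. -/
theorem FeasAug.truncate (h : FeasAug T f X U d φ t x w u z1 z2) (hts : t ≤ s) :
    FeasAug T f X U d φ s (z1 s) (z2 s) u z1 z2 := by
  obtain ⟨-, -, hf, hφ, hU, hX⟩ := h
  exact ⟨rfl, rfl, fun r hr => hf r (hts.trans hr), fun r hr => hφ r (hts.trans hr),
    fun r hr => hU r (hts.trans hr), fun r hr => hX r (hts.trans hr)⟩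

/-- Following a feasible pair up to time `s` and then a feasible pair started from the state
reached at time `s` is feasible. -/
theorem FeasAug.concat (h : FeasAug T f X U d φ t x w u z1 z2) (hts : t < s)
    (h' : FeasAug T f X U d φ s (z1 s) (z2 s) v y1 y2) :
    FeasAug T f X U d φ t x w (fun r => if r < s then u r else v r)
      (fun r => if r < s then z1 r else y1 r) (fun r => if r < s then z2 r else y2 r) := by
  obtain ⟨hx, hw, hf, hφ, hU, hX⟩ := h
  obtain ⟨hx', hw', hf', hφ', hU', hX'⟩ := h'
  refine ⟨by simpa [hts] using hx, by simpa [hts] using hw, ?_, ?_, ?_, ?_⟩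
  · intro r htr hrT
    rcases lt_trichotomy (r + 1) s with hr | rfl | hr
    · simpa [hr, Nat.lt_of_succ_lt hr] using hf r htr hrT
    · simpa [hx'] using hf r htr hrT
    · have hsr : s ≤ r := Nat.le_of_lt_succ hr
      simpa [hr.not_gt, hsr.not_gt] using hf' r hsr hrT
  · intro r htr hrT
    rcases lt_trichotomy (r + 1) s with hr | rfl | hr
    · simpa [hr, Nat.lt_of_succ_lt hr] using hφ r htr hrT
    · simpa [hw'] using hφ r htr hrT
    · have hsr : s ≤ r := Nat.le_of_lt_succ hr
      simpa [hr.not_gt, hsr.not_gt] using hφ' r hsr hrT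
  · intro r htr hrT
    by_cases hr : r < s
    · simpa [hr] using hU r htr hrT
    · simpa [hr] using hU' r (not_lt.mp hr) hrT
  · intro r htr hrT
    by_cases hr : r < s
    · simpa [hr] using hX r htr hrT
    · simpa [hr] using hX' r (not_lt.mp hr) hrT

end

/-- the augmented-state problem satisfies the Principle of Optimality:
for `t0 ≤ t < s < T`, if `(u*, z*)` is feasible and optimal for the augmented problem
started at `(t, (x, w))` with objective `φ_T(z1(T), z2(T))`, then its truncation is
feasible and optimal for the augmented problem started at time `s` from the augmented
state `z*(s) = (z1*(s), z2*(s))`. -/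
theorem augmented_principle_of_optimality
    {n m : ℕ} (t0 T : ℕ)
    (f : (Fin n → ℝ) → (Fin m → ℝ) → ℕ → (Fin n → ℝ))
    (X : ℕ → Set (Fin n → ℝ)) (U : Set (Fin m → ℝ))
    (d : ℕ → ℕ)
    (φ : (i : ℕ) → (Fin n → ℝ) → (Fin m → ℝ) → (Fin (d (i - 1)) → ℝ) → (Fin (d i) → ℝ))
    (φT : (Fin n → ℝ) → (Fin (d (T - 1)) → ℝ) → ℝ)
    (t s : ℕ) (ht0t : t0 ≤ t) (hts : t < s) (hsT : s < T)
    (x : Fin n → ℝ) (w : Fin (d (t - 1)) → ℝ)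
    (ustar : ℕ → (Fin m → ℝ)) (z1star : ℕ → (Fin n → ℝ))
    (z2star : (i : ℕ) → (Fin (d (i - 1)) → ℝ))
    (hfeas : FeasAug T f X U d φ t x w ustar z1star z2star)
    (hopt : ∀ u z1 z2, FeasAug T f X U d φ t x w u z1 z2 →
      φT (z1star T) (z2star T) ≤ φT (z1 T) (z2 T)) :
    FeasAug T f X U d φ s (z1star s) (z2star s) ustar z1star z2star ∧
    ∀ u z1 z2, FeasAug T f X U d φ s (z1star s) (z2star s) u z1 z2 →
      φT (z1star T) (z2star T) ≤ φT (z1 T) (z2 T) := by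
  refine ⟨hfeas.truncate hts.le, fun u z1 z2 h => ?_⟩
  simpa [hsT.not_gt] using hopt _ _ _ (hfeas.concat hts h)
end

section
/- Let J1, J2 : (ℝ^m)^{T−t0} × (ℝ^n)^{T−t0+1} → ℝ admit forward separable representations of dimensions l1 and l2 respectively, and let U : ℝ → ℝ be any function. Then: (i) the pointwise sum G1(u, x) = J1(u, x) + J2(u, x) admits a forward separable representation of dimension at most l1 + l2; (ii) the pointwise product G2(u, x) = J1(u, x) · J2(u, x) admits a forward separable representation of dimension at most l1 + l2; and (iii) the composition G3(u, x) = U(J1(u, x)) admits a forward separable representation of dimension at most l1. -/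
/-- Running two forward recursions side by side represents any binary combination of `J1`
and `J2`. -/
theorem HasFSRepDimLe.map₂ {n m t0 T l1 l2 : ℕ}
    {J1 J2 : (ℕ → (Fin m → ℝ)) → (ℕ → (Fin n → ℝ)) → ℝ} (F : ℝ → ℝ → ℝ)
    (h1 : HasFSRepDimLe n m t0 T l1 J1) (h2 : HasFSRepDimLe n m t0 T l2 J2) :
    HasFSRepDimLe n m t0 T (l1 + l2) (fun u x => F (J1 u x) (J2 u x)) := by
  obtain ⟨d, φ0, φ, φT, hd, hφ⟩ := h1
  obtain ⟨e, ψ0, ψ, ψT, he, hψ⟩ := h2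
  refine ⟨fun i => d i + e i,
    fun x u => Fin.append (φ0 x u) (ψ0 x u),
    fun i x u w => Fin.append (φ i x u fun j => w (Fin.castAdd _ j))
      (ψ i x u fun j => w (Fin.natAdd _ j)),
    fun x w => F (φT x fun j => w (Fin.castAdd _ j)) (ψT x fun j => w (Fin.natAdd _ j)),
    fun i h h' => Nat.add_le_add (hd i h h') (he i h h'), ?_⟩
  intro u x w hw0 hw
  refine congrArg₂ F
    (hφ u x (fun i j => w i (Fin.castAdd _ j)) ?_ fun i h h' => ?_)
    (hψ u x (fun i j => w i (Fin.natAdd _ j)) ?_ fun i h h' => ?_)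
  · funext j
    simp [hw0]
  · funext j
    simp only [hw i h h', Fin.append_left]
  · funext j
    simp [hw0]
  · funext j
    simp only [hw i h h', Fin.append_right]

/-- Post-composition with a real function does not change the dimension. -/
theorem HasFSRepDimLe.map {n m t0 T l : ℕ}
    {J : (ℕ → (Fin m → ℝ)) → (ℕ → (Fin n → ℝ)) → ℝ} (U : ℝ → ℝ)
    (h : HasFSRepDimLe n m t0 T l J) :
    HasFSRepDimLe n m t0 T l (fun u x => U (J u x)) := by
  obtain ⟨d, φ0, φ, φT, hd, hφ⟩ := h
  exact ⟨d, φ0, φ, fun x w => U (φT x w), hd,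
    fun u x w hw0 hw => congrArg U (hφ u x w hw0 hw)⟩

theorem HasFSRepDim.hasFSRepDimLe {n m t0 T l : ℕ}
    {J : (ℕ → (Fin m → ℝ)) → (ℕ → (Fin n → ℝ)) → ℝ}
    (h : HasFSRepDim n m t0 T l J) : HasFSRepDimLe n m t0 T l J := by
  obtain ⟨d, φ0, φ, φT, hd, -, hφ⟩ := h
  exact ⟨d, φ0, φ, φT, hd, hφ⟩

/-- the algebra of forward separable functions.  If `J1` and `J2` admit
forward separable representations of dimensions `l1` and `l2`, and `U : ℝ → ℝ` is any
function, then `J1 + J2` and `J1 · J2` admit representations of dimension at most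
`l1 + l2`, and `U ∘ J1` admits a representation of dimension at most `l1`. -/
theorem forward_separable_algebra
    {n m : ℕ} (t0 T : ℕ) (ht0T : t0 < T) (l1 l2 : ℕ)
    (J1 J2 : (ℕ → (Fin m → ℝ)) → (ℕ → (Fin n → ℝ)) → ℝ)
    (U : ℝ → ℝ)
    (h1 : HasFSRepDim n m t0 T l1 J1)
    (h2 : HasFSRepDim n m t0 T l2 J2) :
    HasFSRepDimLe n m t0 T (l1 + l2) (fun u x => J1 u x + J2 u x) ∧
    HasFSRepDimLe n m t0 T (l1 + l2) (fun u x => J1 u x * J2 u x) ∧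
    HasFSRepDimLe n m t0 T l1 (fun u x => U (J1 u x)) := by
  exact ⟨h1.hasFSRepDimLe.map₂ (· + ·) h2.hasFSRepDimLe,
    h1.hasFSRepDimLe.map₂ (· * ·) h2.hasFSRepDimLe, h1.hasFSRepDimLe.map U⟩
end

section
/- Let N ∈ ℕ with N ≥ 1, let p_j > 0 for j = 1, …, N, and let c_{j,t} : ℝ^n × ℝ^m → [0, ∞) be nonnegative functions for j = 1, …, N and t0 ≤ t ≤ T−1. Then the mixed p-norm function J(u, x) = Σ_{j=1}^N ( Σ_{t=t0}^{T−1} c_{j,t}(x(t), u(t))^{p_j} )^{1/p_j} admits a forward separable representation of dimension N. -/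
/-- the mixed p-norm function
`J(u, x) = Σ_{j=1}^N (Σ_{t=t0}^{T-1} c_{j,t}(x(t), u(t))^{p_j})^{1/p_j}`,
with `p_j > 0` and nonnegative stage costs `c_{j,t}`, admits a forward separable
representation of dimension `N`. -/
theorem mixed_p_norm_is_forward_separable
    {n m : ℕ} (t0 T : ℕ) (ht0T : t0 < T)
    (N : ℕ) (hN : 1 ≤ N)
    (p : Fin N → ℝ) (hp : ∀ j, 0 < p j)
    (c : Fin N → ℕ → (Fin n → ℝ) → (Fin m → ℝ) → ℝ)
    (hc : ∀ j t x u, 0 ≤ c j t x u) :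
    HasFSRepDim n m t0 T N
      (fun u x => ∑ j : Fin N,
        (∑ t ∈ Finset.Ico t0 T, (c j t (x t) (u t)) ^ (p j)) ^ (1 / p j)) := by
  refine ⟨fun _ => N, fun x u j => c j t0 x u ^ p j, fun i x u w j => w j + c j i x u ^ p j,
    fun _ w => ∑ j, w j ^ (1 / p j), fun _ _ _ => le_rfl, ⟨t0, le_rfl, by omega, rfl⟩, ?_⟩
  intro u x w hw0 hw
  have hsum : ∀ k, t0 ≤ k → k ≤ T - 1 → ∀ j,
      w k j = ∑ t ∈ Finset.Ico t0 (k + 1), c j t (x t) (u t) ^ p j := by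
    intro k hk
    induction k, hk using Nat.le_induction with
    | base => simp [hw0]
    | succ k hk ih =>
      intro hkT j
      rw [Finset.sum_Ico_succ_top (by omega), hw (k + 1) (by omega) hkT]
      simp [← ih (by omega) j]
  have hT : T - 1 + 1 = T := by omega
  simp only [hsum (T - 1) (by omega) le_rfl, hT]
end

section
/- Let T ≥ 1 and let a_t : ℝ^n → ℝ for t = 0, …, T. The variance-type function J(u, x) = Σ_{t=0}^{T} ( a_t(x(t)) − (1/(T+1)) Σ_{s=0}^{T} a_s(x(s)) )² admits a forward separable representation of dimension 2; explicitly, one may take φ_0(x, u) = (a_0(x)², a_0(x)), φ_i(x, u, (w1, w2)) = (w1 + a_i(x)², w2 + a_i(x)) for 1 ≤ i ≤ T−1, and φ_T(x, (w1, w2)) = (w1 + a_T(x)²) − (1/(T+1)) (w2 + a_T(x))², using the identity Σ_{t=0}^{T} (a_t(x(t)) − (1/(T+1)) Σ_{s=0}^{T} a_s(x(s)))² = Σ_{t=0}^{T} a_t(x(t))² − (1/(T+1)) (Σ_{s=0}^{T} a_s(x(s)))². -/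
open Finset in
theorem sum_sub_mean_sq_range (b : ℕ → ℝ) (T : ℕ) :
    ∑ t ∈ range (T + 1), (b t - (1 / ((T : ℝ) + 1)) * ∑ s ∈ range (T + 1), b s) ^ 2 =
      ∑ t ∈ range (T + 1), b t ^ 2 - (1 / ((T : ℝ) + 1)) * (∑ t ∈ range (T + 1), b t) ^ 2 := by
  have hT : (T : ℝ) + 1 ≠ 0 := by positivity
  simp only [sub_sq, sum_add_distrib, sum_sub_distrib, ← sum_mul, ← mul_sum, sum_const,
    card_range, nsmul_eq_mul]
  push_cast
  field_simp
  ring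

/-- The forward recursion `w(i) = (w₁ + b_i ^ 2, w₂ + b_i)` computes the partial sums of the squares
and of the values of `b`. -/
theorem forward_recursion_eq_partial_sums (b : ℕ → ℝ) (N : ℕ) (w : ℕ → Fin 2 → ℝ)
    (h0 : w 0 = ![b 0 ^ 2, b 0])
    (hw : ∀ i, 0 < i → i ≤ N → w i = ![w (i - 1) 0 + b i ^ 2, w (i - 1) 1 + b i]) :
    ∀ i ≤ N, w i = ![∑ t ∈ Finset.range (i + 1), b t ^ 2, ∑ t ∈ Finset.range (i + 1), b t] := by
  intro i hi
  induction i with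
  | zero => simp [h0]
  | succ k ih =>
    rw [hw (k + 1) k.succ_pos hi, Nat.add_sub_cancel, ih (by lia), Finset.sum_range_succ _ (k + 1),
      Finset.sum_range_succ _ (k + 1)]
    rfl

/-- the variance-type function
`J(u, x) = Σ_{t=0}^{T} (a_t(x(t)) - (1/(T+1)) Σ_{s=0}^{T} a_s(x(s)))²`
admits a forward separable representation of dimension 2; explicitly one may take
`φ_0(x,u) = (a_0(x)², a_0(x))`, `φ_i(x,u,(w1,w2)) = (w1 + a_i(x)², w2 + a_i(x))`, and
`φ_T(x,(w1,w2)) = (w1 + a_T(x)²) - (1/(T+1))(w2 + a_T(x))²`. -/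
theorem variance_is_forward_separable
    {n m : ℕ} (T : ℕ) (hT : 1 ≤ T)
    (a : ℕ → (Fin n → ℝ) → ℝ) :
    IsFSRep n m 0 T
      (fun _ x => ∑ t ∈ Finset.range (T + 1),
        (a t (x t) - (1 / ((T : ℝ) + 1)) * ∑ s ∈ Finset.range (T + 1), a s (x s)) ^ 2)
      (fun _ => 2)
      (fun x _ => ![(a 0 x) ^ 2, a 0 x])
      (fun i x _ w => ![w 0 + (a i x) ^ 2, w 1 + a i x])
      (fun x w => (w 0 + (a T x) ^ 2) - (1 / ((T : ℝ) + 1)) * (w 1 + a T x) ^ 2) ∧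
    HasFSRepDim n m 0 T 2
      (fun _ x => ∑ t ∈ Finset.range (T + 1),
        (a t (x t) - (1 / ((T : ℝ) + 1)) * ∑ s ∈ Finset.range (T + 1), a s (x s)) ^ 2) := by
  refine (fun h => ⟨h, fun _ => 2, _, _, _, fun _ _ _ => le_rfl,
    ⟨0, le_rfl, Nat.zero_le _, rfl⟩, h⟩) ?_
  intro u x w h0 hw
  have key := forward_recursion_eq_partial_sums (fun t => a t (x t)) (T - 1) w h0 hw (T - 1) le_rfl
  rw [Nat.sub_add_cancel hT] at key
  refine (sum_sub_mean_sq_range (fun t => a t (x t)) T).trans ?_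
  simp only [key, Finset.sum_range_succ _ T,
    Matrix.cons_val_zero, Matrix.cons_val_one]
end

section
/- Consider the two-stage stochastic control problem in which x(0) = 0, x(1) = v(0) with v(0) uniformly distributed on [0, 1], a policy is a measurable map π : ℝ × {0, 1} → {0, 1}, and the expected cost of π is C(π) = −π(0, 0) − ∫₀¹ π(v, 1) dv. Then: (i) C(π) ≥ −2 for every measurable policy π; (ii) the policy π* defined by π*(x, t) = 1 if x ∈ [0, 1) and π*(x, t) = 0 if x = 1 is measurable and achieves C(π*) = −2, hence is optimal; yet (iii) for the subproblem started at time 1 from state x = 1, with cost −u(1) over inputs u(1) ∈ {0, 1}, the input π*(1, 1) = 0 gives cost 0 while u(1) = 1 gives the strictly smaller cost −1, so the optimal policy π* is not optimal for the subproblem at the state x = 1. -/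
open MeasureTheory

/-- Expected cost of a policy `π : ℝ × {0,1} → {0,1}` for the two-stage stochastic
problem with `x(0) = 0`, `x(1) = v(0) ~ U[0,1]`:
`C(π) = -π(0,0) - ∫₀¹ π(v,1) dv`. -/
noncomputable def CostW (π : ℝ → ℕ → ℝ) : ℝ :=
  -π 0 0 - ∫ v in Set.Icc (0 : ℝ) 1, π v 1

/-- The policy `π*(x,t) = 1` if `x ∈ [0,1)` and `π*(x,t) = 0` otherwise (in
particular `π*(1,t) = 0`). -/
noncomputable def piStar : ℝ → ℕ → ℝ :=
  fun x _ => if 0 ≤ x ∧ x < 1 then 1 else 0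

theorem piStar_eq_zero_or_one (x : ℝ) (t : ℕ) : piStar x t = 0 ∨ piStar x t = 1 := by
  unfold piStar
  split_ifs <;> simp

theorem measurable_piStar (t : ℕ) : Measurable fun v => piStar v t :=
  Measurable.ite measurableSet_Ico measurable_const measurable_const

theorem costW_piStar : CostW piStar = -2 := by
  have h : ∫ v in Set.Icc (0 : ℝ) 1, piStar v 1 = 1 := by
    rw [integral_Icc_eq_integral_Ico,
      setIntegral_congr_fun (f := fun v => piStar v 1) (g := fun _ => (1 : ℝ))
        measurableSet_Ico fun v hv => if_pos hv]
    simp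
  have h₀ : piStar 0 0 = 1 := by simp [piStar]
  rw [CostW, h, h₀]
  norm_num

theorem neg_two_le_costW {π : ℝ → ℕ → ℝ} (h : ∀ x t, π x t = 0 ∨ π x t = 1) :
    -2 ≤ CostW π := by
  have hle (x : ℝ) (t : ℕ) : π x t ≤ 1 := by
    rcases h x t with h | h <;> simp [h]
  have hnonneg (x : ℝ) (t : ℕ) : 0 ≤ π x t := by
    rcases h x t with h | h <;> simp [h]
  have hint : ∫ v in Set.Icc (0 : ℝ) 1, π v 1 ≤ ∫ _ in Set.Icc (0 : ℝ) 1, (1 : ℝ) :=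
    integral_mono_of_nonneg (.of_forall fun v => hnonneg v 1) (by simp)
      (.of_forall fun v => hle v 1)
  have hone : ∫ _ in Set.Icc (0 : ℝ) 1, (1 : ℝ) = 1 := by simp
  have h₀ := hle 0 0
  unfold CostW
  linarith

/-- (i) `C(π) ≥ -2` for every measurable `{0,1}`-valued policy;
(ii) `π*` is measurable, `{0,1}`-valued, achieves `C(π*) = -2` and hence is optimal;
yet (iii) for the subproblem started at time 1 from state `x = 1`, with cost `-u(1)`,
the input `π*(1,1) = 0` gives cost `0` while `u(1) = 1` gives the strictly smaller
cost `-1`, so `π*` is not optimal for the subproblem at `x = 1`. -/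
theorem stochastic_principle_of_optimality_counterexample :
    -- (i)
    (∀ π : ℝ → ℕ → ℝ, (∀ t, Measurable fun v => π v t) →
      (∀ x t, π x t = 0 ∨ π x t = 1) → -2 ≤ CostW π) ∧
    -- (ii)
    ((∀ t, Measurable fun v => piStar v t) ∧
      (∀ x t, piStar x t = 0 ∨ piStar x t = 1) ∧
      CostW piStar = -2 ∧
      (∀ π : ℝ → ℕ → ℝ, (∀ t, Measurable fun v => π v t) →
        (∀ x t, π x t = 0 ∨ π x t = 1) → CostW piStar ≤ CostW π)) ∧
    -- (iii)
    (piStar 1 1 = 0 ∧ -(piStar 1 1) = 0 ∧ (-1 : ℝ) < -(piStar 1 1)) := by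
  have h : piStar 1 1 = 0 := by simp [piStar]
  refine ⟨fun π _ hπ => neg_two_le_costW hπ, ⟨measurable_piStar, piStar_eq_zero_or_one,
    costW_piStar, fun π _ hπ => costW_piStar.trans_le (neg_two_le_costW hπ)⟩, h, ?_, ?_⟩ <;>
  simp [h]
end
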